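/- Let Q : (C₊, d_C) → (C₊, d_C) be a continuous map with Q(C_{r*}) ⊆ C_{r*} for some r* ∈ Int(Y₊). Assume Q = L + K where: (1) L : (C₊, ||·||_∞) → (C₊, ||·||_∞) is Lipschitz with Lipschitz constant k ∈ (0,1) for the supremum norm ||·||_∞; and (2) K : (C₊, d_C) → (C₊, d_C) is continuous and K(C_{r*}) is precompact in (C, ||·||_C). Then for every y ∈ ℝ, the forward orbit {(T_y∘Q)ⁿ(r*)}_{n≥1} is precompact in (C, ||·||_C). (Theorem A, Appendix) -/

import Mathlib

open Filter Topology

noncomputable section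

/-- The Euclidean norm on `ℝ^N`. -/
def eNorm {N : ℕ} (a : Fin N → ℝ) : ℝ := Real.sqrt (∑ i, (a i) ^ 2)

/-- Elements of `C = C(M, BC(ℝ, ℝ^N))`, identified with (bounded continuous)
functions on `M × ℝ` with values in `ℝ^N`. -/
abbrev Cfun (M : Type*) (N : ℕ) := M × ℝ → Fin N → ℝ

/-- The sup-norm of `Y = C(M, ℝ^N)`. -/
def normY {M : Type*} {N : ℕ} (g : M → Fin N → ℝ) : ℝ := ⨆ θ : M, eNorm (g θ)

/-- The norm of `X = BC(ℝ, ℝ^N)`:  `∑ₙ 2⁻ⁿ sup_{|x| ≤ n} ‖ψ(x)‖`. -/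
def normX {N : ℕ} (ψ : ℝ → Fin N → ℝ) : ℝ :=
  ∑' n : ℕ, (2 : ℝ)⁻¹ ^ (n + 1) * ⨆ x : {x : ℝ // |x| ≤ (n : ℝ) + 1}, eNorm (ψ x.1)

/-- The norm of `C = C(M, X)`. -/
def normC {M : Type*} {N : ℕ} (φ : Cfun M N) : ℝ := ⨆ θ : M, normX (fun x => φ (θ, x))

/-- Pointwise (coordinatewise) order on `C`. -/
def funLE {M : Type*} {N : ℕ} (φ ψ : Cfun M N) : Prop := ∀ p i, φ p i ≤ ψ p i

/-- Membership in `C₊`: bounded, continuous and nonnegative. -/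
def inCplus {M : Type*} {N : ℕ} [TopologicalSpace M] (φ : Cfun M N) : Prop :=
  Continuous φ ∧ (∃ B, ∀ p i, |φ p i| ≤ B) ∧ ∀ p i, 0 ≤ φ p i

/-- Membership in `Y₊ = C(M, ℝ₊^N)`. -/
def inYplus {M : Type*} {N : ℕ} [TopologicalSpace M] (g : M → Fin N → ℝ) : Prop :=
  Continuous g ∧ ∀ θ i, 0 ≤ g θ i

/-- Membership in `Int(Y₊)`. -/
def inIntYplus {M : Type*} {N : ℕ} [TopologicalSpace M] (g : M → Fin N → ℝ) : Prop :=
  Continuous g ∧ ∀ θ i, 0 < g θ i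

/-- A `Y`-element viewed as an `x`-independent element of `C`. -/
def ofY {M : Type*} {N : ℕ} (g : M → Fin N → ℝ) : Cfun M N := fun p => g p.1

/-- `C_r = {φ ∈ C : 0 ≤ φ ≤ r}` for `r ∈ Y₊`. -/
def inCr {M : Type*} {N : ℕ} [TopologicalSpace M] (r : M → Fin N → ℝ) (φ : Cfun M N) : Prop :=
  inCplus φ ∧ funLE φ (ofY r)

/-- The translation operator `T_y`. -/
def Ty {M : Type*} {N : ℕ} (y : ℝ) (φ : Cfun M N) : Cfun M N := fun p => φ (p.1, p.2 - y)

/-- `Q` maps `C₊` into `C₊`. -/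
def mapsCplus {M : Type*} {N : ℕ} [TopologicalSpace M] (Q : Cfun M N → Cfun M N) : Prop :=
  ∀ φ, inCplus φ → inCplus (Q φ)

/-- Continuity of `Q : C₊ → C₊`: the restriction of `Q` to each `C_r`
(`r` a constant positive vector) is continuous for the metric of `‖·‖_C`. -/
def QContinuous {M : Type*} {N : ℕ} [TopologicalSpace M] (Q : Cfun M N → Cfun M N) : Prop :=
  ∀ r : Fin N → ℝ, (∀ i, 0 < r i) → ∀ φ, inCr (fun _ => r) φ → ∀ ε > (0 : ℝ), ∃ δ > (0 : ℝ),
    ∀ ψ, inCr (fun _ => r) ψ → normC (fun p i => ψ p i - φ p i) < δ →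
      normC (fun p i => Q ψ p i - Q φ p i) < ε

/-- Monotonicity (order preservation) of `Q` on `C₊`. -/
def QMonotone {M : Type*} {N : ℕ} [TopologicalSpace M] (Q : Cfun M N → Cfun M N) : Prop :=
  ∀ φ ψ, inCplus φ → inCplus ψ → funLE φ ψ → funLE (Q φ) (Q ψ)

/-- Assumption (A): `Q₊` is a continuous limiting map with fixed point `r* ∈ Int(Y₊)`
and `T_{-y} ∘ Qⁿ ∘ T_y [φ] → Q₊ⁿ[φ]` in `C` as `y → ∞`. -/
def AssumptionA {M : Type*} {N : ℕ} [TopologicalSpace M] (Q Qplus : Cfun M N → Cfun M N)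
    (rstar : M → Fin N → ℝ) : Prop :=
  inIntYplus rstar ∧ mapsCplus Qplus ∧ QContinuous Qplus ∧ Qplus (ofY rstar) = ofY rstar ∧
    ∀ φ, inCplus φ → ∀ n : ℕ,
      Tendsto (fun y : ℝ =>
        normC (fun p i => Ty (-y) (Q^[n] (Ty y φ)) p i - Qplus^[n] φ p i)) atTop (nhds 0)

/-- Assumption (UB) for the exhausting sequence `φk`. -/
def AssumptionUB {M : Type*} {N : ℕ} [TopologicalSpace M] (Q : Cfun M N → Cfun M N)
    (φk : ℕ → M → Fin N → ℝ) : Prop :=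
  (∀ k, inIntYplus (φk k)) ∧
  (∀ k, funLE (ofY (φk k)) (ofY (φk (k + 1))) ∧ φk k ≠ φk (k + 1)) ∧
  (∀ g : M → Fin N → ℝ, inYplus g → ∃ k, ∀ θ i, g θ i ≤ φk k θ i) ∧
  (∀ k φ, inCr (φk k) φ → inCr (φk k) (Q φ))

/-- Assumption (SP): strong positivity. -/
def AssumptionSP {M : Type*} {N : ℕ} [TopologicalSpace M] (Q : Cfun M N → Cfun M N) : Prop :=
  ∃ (ρ ϱ : ℝ) (Nstar : ℕ), 0 < ρ ∧ ρ < ϱ ∧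
    ∀ (a : ℝ) (φ : Cfun M N), inCplus φ → φ ≠ 0 → (fun θ => φ (θ, a)) ≠ 0 →
      ∀ n, Nstar ≤ n → ∀ x ∈ Set.Icc (a + n * ρ) (a + n * ϱ), ∀ θ i, 0 < Q^[n] φ (θ, x) i

/-- Assumption (UC) for `Q₊` with leftward/rightward speeds `cm = c₋*`, `cp = c₊*`. -/
def AssumptionUC {M : Type*} {N : ℕ} [TopologicalSpace M] (Qplus : Cfun M N → Cfun M N)
    (rstar : M → Fin N → ℝ) (cm cp : ℝ) : Prop :=
  0 < cp + cm ∧ ∀ ε : ℝ, 0 < ε → ε < (cp + cm) / 2 → ∀ φ : Cfun M N, inCplus φ → φ ≠ 0 →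
    Tendsto (fun n : ℕ =>
      sSup {v : ℝ | ∃ x ∈ Set.Icc ((n : ℝ) * (-cm + ε)) ((n : ℝ) * (cp - ε)),
        v = normY (fun θ i => Qplus^[n] φ (θ, x) i - rstar θ i)}) atTop (nhds 0)

/-- Assumption (GUAA₋): generalized uniform asymptotic annihilation at `-∞`. -/
def AssumptionGUAAm {M : Type*} {N : ℕ} [TopologicalSpace M]
    (Q : Cfun M N → Cfun M N) : Prop :=
  ∃ (rss : ℕ → M → Fin N → ℝ) (Qh Qhp : ℕ → Cfun M N → Cfun M N),
    (∀ l, inIntYplus (rss l)) ∧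
    (∀ φ, inCplus φ → ∃ l, funLE φ (ofY (rss l))) ∧
    (∀ l φ ψ, inCplus φ → inCplus ψ → funLE φ ψ → funLE ψ (ofY (rss l)) →
      funLE (Q φ) (Qh l φ) ∧ funLE (Qh l φ) (Qh l ψ) ∧
        funLE (Qh l ψ) (Qh l (ofY (rss l))) ∧ funLE (Qh l (ofY (rss l))) (ofY (rss l))) ∧
    (∀ l, Tendsto (fun n : ℕ =>
        normY (fun θ => (Qhp l)^[n] (ofY (rss l)) (θ, 0))) atTop (nhds 0)) ∧
    (∀ l (n : ℕ) (i : Fin N), 0 ≤ Filter.liminf (fun y : ℝ =>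
        ⨅ θ, ((Qhp l)^[n] (ofY (rss l)) (θ, 0) i
          - Ty (-y) ((Qh l)^[n] (Ty y (ofY (rss l)))) (θ, 0) i)) atBot)

/-- Sequential precompactness of a subset of `C` with respect to the metric of `‖·‖_C`
(the compact open topology): every sequence in `s` has a subsequence converging in
`‖·‖_C` to some (bounded continuous) element of `C`. -/
def seqPrecompact {M : Type*} {N : ℕ} [TopologicalSpace M] (s : Set (Cfun M N)) : Prop :=
  ∀ u : ℕ → Cfun M N, (∀ n, u n ∈ s) → ∃ (g : Cfun M N) (ι : ℕ → ℕ), StrictMono ι ∧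
    Continuous g ∧ (∃ B, ∀ p i, |g p i| ≤ B) ∧
    Tendsto (fun n => normC (fun p i => u (ι n) p i - g p i)) atTop (nhds 0)

/-- The supremum norm `‖·‖_∞` on bounded continuous functions `M × ℝ → ℝ^N`. -/
def normSup {M : Type*} {N : ℕ} (φ : Cfun M N) : ℝ := ⨆ p : M × ℝ, eNorm (φ p)

section Norms

variable {M : Type*} {N : ℕ}

lemma eNorm_nonneg (a : Fin N → ℝ) : 0 ≤ eNorm a := Real.sqrt_nonneg _

lemma abs_le_eNorm (a : Fin N → ℝ) (i : Fin N) : |a i| ≤ eNorm a :=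
  Real.abs_le_sqrt (Finset.single_le_sum (f := fun j => a j ^ 2)
    (fun j _ => sq_nonneg (a j)) (Finset.mem_univ i))

lemma eNorm_le_of_abs_le {a : Fin N → ℝ} {B : ℝ} (h : ∀ i, |a i| ≤ B) : eNorm a ≤ N * B := by
  have hsum : eNorm a ≤ ∑ i, |a i| := by
    refine Real.sqrt_le_iff.2 ⟨Finset.sum_nonneg fun i _ => abs_nonneg (a i), ?_⟩
    calc ∑ i, a i ^ 2 = ∑ i, |a i| ^ 2 := by simp only [sq_abs]
      _ ≤ (∑ i, |a i|) ^ 2 := Finset.sum_sq_le_sq_sum_of_nonneg fun i _ => abs_nonneg (a i)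
  calc eNorm a ≤ ∑ i, |a i| := hsum
    _ ≤ ∑ _i : Fin N, B := Finset.sum_le_sum fun i _ => h i
    _ = N * B := by simp

lemma summable_inv_two_pow_succ : Summable fun n : ℕ => (2 : ℝ)⁻¹ ^ (n + 1) :=
  (summable_nat_add_iff 1).2 (summable_geometric_of_lt_one (by norm_num) (by norm_num))

lemma eNorm_le_normSup {h : Cfun M N} {c : ℝ} (hc : ∀ p, eNorm (h p) ≤ c) (p : M × ℝ) :
    eNorm (h p) ≤ normSup h :=
  le_ciSup (f := fun p => eNorm (h p)) ⟨c, by rintro _ ⟨q, rfl⟩; exact hc q⟩ p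

lemma normSup_le {h : Cfun M N} {c : ℝ} (hc0 : 0 ≤ c) (hc : ∀ p, eNorm (h p) ≤ c) :
    normSup h ≤ c :=
  Real.iSup_le hc hc0

lemma iSup_eNorm_nonneg {ι : Sort*} (ψ : ι → Fin N → ℝ) : 0 ≤ ⨆ x, eNorm (ψ x) :=
  Real.iSup_nonneg fun x => eNorm_nonneg (ψ x)

lemma weighted_iSup_nonneg {ι : Sort*} (ψ : ι → Fin N → ℝ) (n : ℕ) :
    0 ≤ (2 : ℝ)⁻¹ ^ (n + 1) * ⨆ x, eNorm (ψ x) :=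
  mul_nonneg (by positivity) (iSup_eNorm_nonneg ψ)

lemma weighted_iSup_le {ι : Sort*} {ψ : ι → Fin N → ℝ} {c : ℝ} (hc0 : 0 ≤ c)
    (hc : ∀ x, eNorm (ψ x) ≤ c) (n : ℕ) :
    (2 : ℝ)⁻¹ ^ (n + 1) * ⨆ x, eNorm (ψ x) ≤ (2 : ℝ)⁻¹ ^ (n + 1) * c :=
  mul_le_mul_of_nonneg_left (Real.iSup_le hc hc0) (by positivity)

lemma summable_weighted_iSup {ι : ℕ → Sort*} {ψ : ∀ n, ι n → Fin N → ℝ} {c : ℝ} (hc0 : 0 ≤ c)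
    (hc : ∀ n x, eNorm (ψ n x) ≤ c) :
    Summable fun n : ℕ => (2 : ℝ)⁻¹ ^ (n + 1) * ⨆ x, eNorm (ψ n x) :=
  Summable.of_nonneg_of_le (fun n => weighted_iSup_nonneg (ψ n) n)
    (fun n => weighted_iSup_le hc0 (hc n) n) (summable_inv_two_pow_succ.mul_right c)

lemma normX_nonneg (ψ : ℝ → Fin N → ℝ) : 0 ≤ normX ψ :=
  tsum_nonneg fun n => weighted_iSup_nonneg (fun x : {x : ℝ // |x| ≤ (n : ℝ) + 1} => ψ x.1) n

lemma normC_nonneg (h : Cfun M N) : 0 ≤ normC h :=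
  Real.iSup_nonneg fun _ => normX_nonneg _

lemma summable_normX_terms {ψ : ℝ → Fin N → ℝ} {c : ℝ} (hc0 : 0 ≤ c)
    (hc : ∀ x, eNorm (ψ x) ≤ c) :
    Summable fun n : ℕ =>
      (2 : ℝ)⁻¹ ^ (n + 1) * ⨆ x : {x : ℝ // |x| ≤ (n : ℝ) + 1}, eNorm (ψ x.1) :=
  summable_weighted_iSup (ι := fun n : ℕ => {x : ℝ // |x| ≤ (n : ℝ) + 1})
    (ψ := fun _ x => ψ x.1) hc0 fun _ x => hc x.1

lemma normX_le {ψ : ℝ → Fin N → ℝ} {c : ℝ} (hc0 : 0 ≤ c) (hc : ∀ x, eNorm (ψ x) ≤ c) :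
    normX ψ ≤ ∑' n : ℕ, (2 : ℝ)⁻¹ ^ (n + 1) * c :=
  Summable.tsum_le_tsum
    (fun n => weighted_iSup_le (ψ := fun x : {x : ℝ // |x| ≤ (n : ℝ) + 1} => ψ x.1) hc0
      (fun x => hc x.1) n)
    (summable_normX_terms hc0 hc) (summable_inv_two_pow_succ.mul_right c)

lemma eNorm_le_mul_normX {ψ : ℝ → Fin N → ℝ} {c : ℝ} (hc : ∀ x, eNorm (ψ x) ≤ c) {n : ℕ}
    {x : ℝ} (hx : |x| ≤ (n : ℝ) + 1) : eNorm (ψ x) ≤ 2 ^ (n + 1) * normX ψ := by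
  have hc0 : 0 ≤ c := (eNorm_nonneg _).trans (hc x)
  have hsup : eNorm (ψ x) ≤ ⨆ x : {x : ℝ // |x| ≤ (n : ℝ) + 1}, eNorm (ψ x.1) :=
    le_ciSup (f := fun x : {x : ℝ // |x| ≤ (n : ℝ) + 1} => eNorm (ψ x.1))
      ⟨c, by rintro _ ⟨q, rfl⟩; exact hc q.1⟩ ⟨x, hx⟩
  have hterm := (summable_normX_terms hc0 hc).le_tsum n fun m _ =>
    weighted_iSup_nonneg (fun x : {x : ℝ // |x| ≤ (m : ℝ) + 1} => ψ x.1) m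
  have hle : (2 : ℝ)⁻¹ ^ (n + 1) * eNorm (ψ x) ≤ normX ψ :=
    (mul_le_mul_of_nonneg_left hsup (by positivity)).trans hterm
  calc eNorm (ψ x) = 2 ^ (n + 1) * ((2 : ℝ)⁻¹ ^ (n + 1) * eNorm (ψ x)) := by
        rw [← mul_assoc, ← mul_pow, mul_inv_cancel₀ two_ne_zero, one_pow, one_mul]
    _ ≤ 2 ^ (n + 1) * normX ψ := mul_le_mul_of_nonneg_left hle (by positivity)

lemma normC_le_tsum {h : Cfun M N} {c : ℝ} (hc0 : 0 ≤ c) (hc : ∀ p, eNorm (h p) ≤ c) :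
    normC h ≤ ∑' n : ℕ, (2 : ℝ)⁻¹ ^ (n + 1) *
      ⨆ p : {p : M × ℝ // |p.2| ≤ (n : ℝ) + 1}, eNorm (h p.1) := by
  refine Real.iSup_le (fun θ => ?_) (tsum_nonneg fun n =>
    weighted_iSup_nonneg (fun p : {p : M × ℝ // |p.2| ≤ (n : ℝ) + 1} => h p.1) n)
  have hS := summable_weighted_iSup (ι := fun n : ℕ => {p : M × ℝ // |p.2| ≤ (n : ℝ) + 1})
    (ψ := fun _ p => h p.1) hc0 fun _ p => hc p.1
  refine Summable.tsum_le_tsum (fun n => ?_)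
    (summable_normX_terms (ψ := fun x => h (θ, x)) hc0 fun x => hc (θ, x)) hS
  refine weighted_iSup_le (ψ := fun x : {x : ℝ // |x| ≤ (n : ℝ) + 1} => h (θ, x.1))
    (iSup_eNorm_nonneg _) (fun x => ?_) n
  exact le_ciSup (f := fun p : {p : M × ℝ // |p.2| ≤ (n : ℝ) + 1} => eNorm (h p.1))
    ⟨c, by rintro _ ⟨q, rfl⟩; exact hc q.1⟩ ⟨(θ, x.1), x.2⟩

lemma eNorm_le_mul_normC {h : Cfun M N} {c : ℝ} (hc : ∀ p, eNorm (h p) ≤ c) {n : ℕ}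
    {p : M × ℝ} (hp : |p.2| ≤ (n : ℝ) + 1) : eNorm (h p) ≤ 2 ^ (n + 1) * normC h := by
  have hc0 : 0 ≤ c := (eNorm_nonneg _).trans (hc p)
  have hX : normX (fun x => h (p.1, x)) ≤ normC h := by
    refine le_ciSup (f := fun θ => normX (fun x => h (θ, x)))
      ⟨∑' n : ℕ, (2 : ℝ)⁻¹ ^ (n + 1) * c, ?_⟩ p.1
    rintro _ ⟨θ, rfl⟩
    exact normX_le hc0 fun x => hc (θ, x)
  exact (eNorm_le_mul_normX (ψ := fun x => h (p.1, x)) (fun x => hc (p.1, x)) hp).trans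
    (mul_le_mul_of_nonneg_left hX (by positivity))

end Norms

section Convergence

variable {M : Type*} {N : ℕ} [TopologicalSpace M]

lemma exists_nat_abs_snd_le {s : Set (M × ℝ)} (hs : IsCompact s) :
    ∃ n : ℕ, ∀ p ∈ s, |p.2| ≤ (n : ℝ) + 1 := by
  obtain ⟨b, hb⟩ := hs.exists_bound_of_continuousOn (f := Prod.snd) continuous_snd.continuousOn
  obtain ⟨n, hn⟩ := exists_nat_ge b
  exact ⟨n, fun p hp => (hb p hp).trans (by linarith)⟩

/-- Convergence in `‖·‖_C` of bounded functions implies locally uniform convergence. -/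
lemma tendsto_of_tendsto_normC {ι : Type*} {l : Filter ι} {F : ι → C(M × ℝ, Fin N → ℝ)}
    {f : C(M × ℝ, Fin N → ℝ)} (hF : ∀ j, ∃ B, ∀ p i, |F j p i| ≤ B)
    (hf : ∃ B, ∀ p i, |f p i| ≤ B)
    (h : Tendsto (fun j => normC (fun p i => F j p i - f p i)) l (𝓝 0)) :
    Tendsto F l (𝓝 f) := by
  rw [ContinuousMap.tendsto_iff_forall_isCompact_tendstoUniformlyOn]
  intro s hs
  obtain ⟨n, hn⟩ := exists_nat_abs_snd_le hs
  rw [Metric.tendstoUniformlyOn_iff]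
  intro ε hε
  have h2 : Tendsto (fun j => 2 ^ (n + 1) * normC (fun p i => F j p i - f p i)) l (𝓝 0) := by
    simpa using h.const_mul ((2 : ℝ) ^ (n + 1))
  filter_upwards [h2.eventually (gt_mem_nhds hε)] with j hj p hp
  obtain ⟨B, hB⟩ := hF j
  obtain ⟨B', hB'⟩ := hf
  have hc : ∀ p, eNorm (fun i => F j p i - f p i) ≤ N * (B + B') := fun p =>
    eNorm_le_of_abs_le fun i => (abs_sub _ _).trans (add_le_add (hB p i) (hB' p i))
  rw [dist_comm, dist_pi_lt_iff hε]
  intro i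
  rw [Real.dist_eq]
  exact ((abs_le_eNorm (fun i => F j p i - f p i) i).trans
    (eNorm_le_mul_normC (h := fun p i => F j p i - f p i) hc (hn p hp))).trans_lt hj

/-- For uniformly bounded families, locally uniform convergence implies convergence
in `‖·‖_C`. -/
lemma tendsto_normC_of_tendsto [CompactSpace M] {ι : Type*} {l : Filter ι}
    {F : ι → C(M × ℝ, Fin N → ℝ)} {f : C(M × ℝ, Fin N → ℝ)} {B : ℝ} (hB0 : 0 ≤ B)
    (hF : ∀ j p i, |F j p i| ≤ B) (hf : ∀ p i, |f p i| ≤ B) (h : Tendsto F l (𝓝 f)) :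
    Tendsto (fun j => normC (fun p i => F j p i - f p i)) l (𝓝 0) := by
  have hc0 : 0 ≤ N * (B + B) := by positivity
  have hc : ∀ j p, eNorm (fun i => F j p i - f p i) ≤ N * (B + B) := fun j p =>
    eNorm_le_of_abs_le fun i => (abs_sub _ _).trans (add_le_add (hF j p i) (hf p i))
  rw [ContinuousMap.tendsto_iff_forall_isCompact_tendstoUniformlyOn] at h
  refine squeeze_zero (fun j => normC_nonneg _)
    (fun j => normC_le_tsum (h := fun p i => F j p i - f p i) hc0 (hc j)) ?_
  rw [show (0 : ℝ) = ∑' _ : ℕ, (0 : ℝ) by simp]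
  refine tendsto_tsum_of_dominated_convergence
    (summable_inv_two_pow_succ.mul_right (N * (B + B))) (fun n => ?_)
    (Eventually.of_forall fun j n => ?_)
  · have hK : IsCompact (Set.univ ×ˢ Set.Icc (-((n : ℝ) + 1)) ((n : ℝ) + 1) : Set (M × ℝ)) :=
      isCompact_univ.prod isCompact_Icc
    have hu := Metric.tendstoUniformlyOn_iff.1 (h _ hK)
    suffices hs : Tendsto (fun j => ⨆ p : {p : M × ℝ // |p.2| ≤ (n : ℝ) + 1},
        eNorm (fun i => F j p.1 i - f p.1 i)) l (𝓝 0) by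
      simpa using hs.const_mul ((2 : ℝ)⁻¹ ^ (n + 1))
    rw [Metric.tendsto_nhds]
    intro ε hε
    have hδ : 0 < ε / (2 * (N + 1)) := by positivity
    filter_upwards [hu _ hδ] with j hj
    rw [Real.dist_0_eq_abs, abs_of_nonneg (iSup_eNorm_nonneg _)]
    have hle : (⨆ p : {p : M × ℝ // |p.2| ≤ (n : ℝ) + 1},
        eNorm (fun i => F j p.1 i - f p.1 i)) ≤ N * (ε / (2 * (N + 1))) := by
      refine Real.iSup_le (fun p => eNorm_le_of_abs_le fun i => ?_) (by positivity)
      have hd := hj p.1 ⟨Set.mem_univ _, abs_le.1 p.2⟩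
      rw [dist_comm, dist_pi_lt_iff hδ] at hd
      simpa [Real.dist_eq] using (hd i).le
    refine hle.trans_lt ?_
    rw [mul_div_assoc', div_lt_iff₀ (by positivity)]
    nlinarith [(Nat.cast_nonneg N : (0 : ℝ) ≤ N)]
  · rw [Real.norm_of_nonneg (mul_nonneg (by positivity) (iSup_eNorm_nonneg _))]
    exact mul_le_mul_of_nonneg_left (Real.iSup_le (fun p => hc j p.1) hc0) (by positivity)

end Convergence

section TotallyBounded

lemma totallyBounded_of_forall_tendsto_subseq {X : Type*} [UniformSpace X] {s : Set X}
    (h : ∀ u : ℕ → X, (∀ n, u n ∈ s) →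
      ∃ (x : X) (φ : ℕ → ℕ), StrictMono φ ∧ Tendsto (u ∘ φ) atTop (𝓝 x)) :
    TotallyBounded s := by
  intro V hV
  by_contra! hcov
  obtain ⟨u, hu, hsep⟩ :
      ∃ u : ℕ → X, (∀ n, u n ∈ s) ∧ ∀ n m, m < n → u m ∉ UniformSpace.ball (u n) V := by
    simp only [Set.not_subset, Set.mem_iUnion₂, not_exists, exists_prop] at hcov
    simpa only [forall_and, Set.forall_mem_image, not_and] using! Set.seq_of_forall_finite_exists hcov
  obtain ⟨x, φ, hφ, hx⟩ := h u hu
  obtain ⟨n, hn⟩ := hx.cauchySeq.mem_entourage hV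
  exact hsep (φ (n + 1)) (φ n) (hφ n.lt_succ_self) (hn (n + 1) n n.le_succ le_rfl)

lemma totallyBounded_of_forall_approx {X : Type*} [UniformSpace X] {s : Set X}
    (h : ∀ V ∈ uniformity X, ∃ t, TotallyBounded t ∧ ∀ x ∈ s, ∃ z ∈ t, (x, z) ∈ V) :
    TotallyBounded s := by
  intro V hV
  obtain ⟨W, hW, hWV⟩ := comp_mem_uniformity_sets hV
  obtain ⟨t, ht, hst⟩ := h W hW
  obtain ⟨c, hc, htc⟩ := ht W hW
  refine ⟨c, hc, fun x hx => ?_⟩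
  obtain ⟨z, hz, hxz⟩ := hst x hx
  obtain ⟨w, hw, hzw⟩ := Set.mem_iUnion₂.1 (htc hz)
  exact Set.mem_iUnion₂.2 ⟨w, hw, hWV ⟨z, hxz, hzw⟩⟩

end TotallyBounded

section Orbit

variable {M : Type*} {N : ℕ} [TopologicalSpace M]

lemma exists_pos_forall_eNorm_le_mem {V : Set (C(M × ℝ, Fin N → ℝ) × C(M × ℝ, Fin N → ℝ))}
    (hV : V ∈ uniformity C(M × ℝ, Fin N → ℝ)) :
    ∃ ε > 0, ∀ f g : C(M × ℝ, Fin N → ℝ), (∀ p, eNorm (fun i => f p i - g p i) < ε) →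
      (f, g) ∈ V := by
  obtain ⟨s, W, -, hW, hsub⟩ := (ContinuousMap.mem_compactConvergence_entourage_iff V).1 hV
  obtain ⟨ε, hε, hεW⟩ := Metric.mem_uniformity_dist.1 hW
  refine ⟨ε, hε, fun f g hfg => hsub fun p _ => hεW ?_⟩
  rw [dist_pi_lt_iff hε]
  exact fun i => (abs_le_eNorm (fun i => f p i - g p i) i).trans_lt (hfg p)

/-- The continuous functions on `M × ℝ` whose coordinates take values in `[0, B]`. -/
def boxSet (M : Type*) [TopologicalSpace M] (N : ℕ) (B : ℝ) : Set C(M × ℝ, Fin N → ℝ) :=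
  {f | ∀ p i, 0 ≤ f p i ∧ f p i ≤ B}

lemma isClosed_boxSet (B : ℝ) : IsClosed (boxSet M N B) := by
  simp only [boxSet, Set.ofPred_forall]
  refine isClosed_iInter fun p => isClosed_iInter fun i => ?_
  have hc : Continuous fun f : C(M × ℝ, Fin N → ℝ) => f p i :=
    (continuous_apply i).comp (continuous_eval_const p)
  exact (isClosed_le continuous_const hc).inter (isClosed_le hc continuous_const)

lemma abs_le_of_mem_boxSet {B : ℝ} {f : C(M × ℝ, Fin N → ℝ)} (hf : f ∈ boxSet M N B)
    (p : M × ℝ) (i : Fin N) : |f p i| ≤ B := by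
  rw [abs_of_nonneg (hf p i).1]
  exact (hf p i).2

lemma inCplus_of_mem_boxSet {B : ℝ} {f : C(M × ℝ, Fin N → ℝ)} (hf : f ∈ boxSet M N B) :
    inCplus (f : Cfun M N) :=
  ⟨f.continuous, ⟨B, abs_le_of_mem_boxSet hf⟩, fun p i => (hf p i).1⟩

lemma inCr_of_mem_boxSet {B : ℝ} {f : C(M × ℝ, Fin N → ℝ)} (hf : f ∈ boxSet M N B) :
    inCr (fun _ _ => B) (f : Cfun M N) :=
  ⟨inCplus_of_mem_boxSet hf, fun p i => (hf p i).2⟩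

/-- Translation by `y` on continuous functions. -/
def translateMap (y : ℝ) (f : C(M × ℝ, Fin N → ℝ)) : C(M × ℝ, Fin N → ℝ) :=
  f.comp ⟨fun p => (p.1, p.2 - y), by fun_prop⟩

lemma translateMap_apply (y : ℝ) (f : C(M × ℝ, Fin N → ℝ)) (p : M × ℝ) :
    translateMap y f p = f (p.1, p.2 - y) := rfl

lemma continuous_translateMap (y : ℝ) :
    Continuous (translateMap y : C(M × ℝ, Fin N → ℝ) → C(M × ℝ, Fin N → ℝ)) :=
  ContinuousMap.continuous_precomp _

/-- Along an orbit `u (n + 1) = T_y (Λ (u n) + a n)`, if `Λ` contracts the supremum norm and the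
`a n` form a totally bounded set for locally uniform convergence, then so do the `u n`: up to an
error `k ^ m * D` in the supremum norm, `u n` depends continuously on `m` of the terms `a j`. -/
lemma totallyBounded_range_orbit [CompleteSpace C(M × ℝ, Fin N → ℝ)] {y k B : ℝ}
    (hk0 : 0 ≤ k) (hk1 : k < 1) (hB : 0 < B)
    {Λ : C(M × ℝ, Fin N → ℝ) → C(M × ℝ, Fin N → ℝ)} {u a : ℕ → C(M × ℝ, Fin N → ℝ)}
    (hu : ∀ n, u n ∈ boxSet M N B) (ha : ∀ n, a n ∈ boxSet M N B)
    (hatb : TotallyBounded (Set.range a))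
    (hstep : ∀ n, u (n + 1) = translateMap y (Λ (u n) + a n))
    (hΛc : ∀ R, 0 < R → ContinuousOn Λ (boxSet M N R))
    (hΛb : ∀ R, 0 < R → ∃ R', 0 < R' ∧ Set.MapsTo Λ (boxSet M N R) (boxSet M N R'))
    (hΛL : ∀ R f g c, f ∈ boxSet M N R → g ∈ boxSet M N R → 0 ≤ c →
      (∀ p, eNorm (fun i => f p i - g p i) ≤ c) →
      ∀ p, eNorm (fun i => Λ f p i - Λ g p i) ≤ k * c) :
    TotallyBounded (Set.range u) := by
  have hA : IsCompact (closure (Set.range a)) := hatb.closure.isCompact_of_isClosed isClosed_closure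
  have hAB : closure (Set.range a) ⊆ boxSet M N B :=
    closure_minimal (by rintro _ ⟨n, rfl⟩; exact ha n) (isClosed_boxSet B)
  have hD : 0 ≤ N * B := by positivity
  have happrox : ∀ m : ℕ, ∃ S R, IsCompact S ∧ B ≤ R ∧ S ⊆ boxSet M N R ∧
      ∀ n, ∃ s ∈ S, ∀ p, eNorm (fun i => u n p i - s p i) ≤ k ^ m * (N * B) := by
    intro m
    induction m with
    | zero =>
      refine ⟨{u 0}, B, isCompact_singleton, le_rfl, by simpa using hu 0, fun n =>
        ⟨u 0, rfl, fun p => ?_⟩⟩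
      rw [pow_zero, one_mul]
      refine eNorm_le_of_abs_le fun i => abs_le.2 ⟨?_, ?_⟩ <;>
        linarith [(hu n p i).1, (hu n p i).2, (hu 0 p i).1, (hu 0 p i).2]
    | succ m ih =>
      obtain ⟨S, R, hS, hBR, hSR, hSu⟩ := ih
      obtain ⟨R', hR', hΛR⟩ := hΛb R (hB.trans_le hBR)
      have hcont : ContinuousOn (fun q : C(M × ℝ, Fin N → ℝ) × C(M × ℝ, Fin N → ℝ) =>
          translateMap y (Λ q.1 + q.2)) (S ×ˢ closure (Set.range a)) := by
        refine (continuous_translateMap y).comp_continuousOn (ContinuousOn.add ?_ continuousOn_snd)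
        exact (hΛc R (hB.trans_le hBR)).comp continuousOn_fst fun q hq => hSR hq.1
      refine ⟨insert (u 0) ((fun q : C(M × ℝ, Fin N → ℝ) × C(M × ℝ, Fin N → ℝ) =>
        translateMap y (Λ q.1 + q.2)) '' (S ×ˢ closure (Set.range a))), R' + B,
        ((hS.prod hA).image_of_continuousOn hcont).insert _, by linarith, ?_, fun n => ?_⟩
      · rintro _ (rfl | ⟨q, hq, rfl⟩)
        · exact fun p i => ⟨(hu 0 p i).1, by linarith [(hu 0 p i).2]⟩
        · intro p i
          have h1 := hΛR (hSR hq.1) (p.1, p.2 - y) i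
          have h2 := hAB hq.2 (p.1, p.2 - y) i
          simp only [translateMap_apply, ContinuousMap.add_apply, Pi.add_apply]
          exact ⟨add_nonneg h1.1 h2.1, add_le_add h1.2 h2.2⟩
      · cases n with
        | zero =>
          refine ⟨u 0, Set.mem_insert _ _, fun p => ?_⟩
          have h0 : eNorm (fun i => u 0 p i - u 0 p i) ≤ N * 0 :=
            eNorm_le_of_abs_le fun i => by simp
          rw [mul_zero] at h0
          exact h0.trans (by positivity)
        | succ n =>
          obtain ⟨s, hs, hus⟩ := hSu n
          refine ⟨_, Set.mem_insert_of_mem _ ⟨(s, a n), ⟨hs, subset_closure ⟨n, rfl⟩⟩, rfl⟩,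
            fun p => ?_⟩
          have hun : u n ∈ boxSet M N R := fun p i => ⟨(hu n p i).1, (hu n p i).2.trans hBR⟩
          have hl := hΛL R (u n) s _ hun (hSR hs) (by positivity) hus (p.1, p.2 - y)
          simp only [hstep n, translateMap_apply, ContinuousMap.add_apply, Pi.add_apply,
            add_sub_add_right_eq_sub]
          rwa [pow_succ', mul_assoc]
  refine totallyBounded_of_forall_approx fun V hV => ?_
  obtain ⟨ε, hε, hεV⟩ := exists_pos_forall_eNorm_le_mem hV
  have hlim : Tendsto (fun m : ℕ => k ^ m * (N * B)) atTop (𝓝 0) := by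
    simpa using (tendsto_pow_atTop_nhds_zero_of_lt_one hk0 hk1).mul_const (N * B)
  obtain ⟨m, hm⟩ := (hlim.eventually (gt_mem_nhds hε)).exists
  obtain ⟨S, R, hS, -, -, hSu⟩ := happrox m
  refine ⟨S, hS.totallyBounded, ?_⟩
  rintro _ ⟨n, rfl⟩
  obtain ⟨s, hs, hus⟩ := hSu n
  exact ⟨s, hs, hεV _ _ fun p => (hus p).trans_lt hm⟩

/-- Continuity of an operator on `C₊` for `‖·‖_C`, on bounded subsets, read as continuity for
locally uniform convergence. -/
lemma QContinuous.continuousOn_boxSet [CompactSpace M] {G : Cfun M N → Cfun M N}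
    (hG : QContinuous G) (hmaps : mapsCplus G)
    {G' : C(M × ℝ, Fin N → ℝ) → C(M × ℝ, Fin N → ℝ)}
    (hG' : ∀ f : C(M × ℝ, Fin N → ℝ), inCplus (f : Cfun M N) → (G' f : Cfun M N) = G f)
    {R : ℝ} (hR : 0 < R) : ContinuousOn G' (boxSet M N R) := by
  have hbdd : ∀ f ∈ boxSet M N R, ∃ B, ∀ p i, |G' f p i| ≤ B := fun f hf => by
    rw [hG' f (inCplus_of_mem_boxSet hf)]
    exact (hmaps f (inCplus_of_mem_boxSet hf)).2.1
  rw [continuousOn_iff_continuous_domRestrict, continuous_iff_continuousAt]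
  rintro ⟨f, hf⟩
  refine tendsto_of_tendsto_normC (fun g => hbdd g.1 g.2) (hbdd f hf) ?_
  have hsub : Tendsto (fun g : boxSet M N R => normC (fun p i => g.1 p i - f p i))
      (𝓝 ⟨f, hf⟩) (𝓝 0) :=
    tendsto_normC_of_tendsto hR.le (fun g => abs_le_of_mem_boxSet g.2) (abs_le_of_mem_boxSet hf)
      continuous_subtype_val.continuousAt
  rw [Metric.tendsto_nhds]
  intro ε hε
  obtain ⟨δ, hδ, hδε⟩ := hG (fun _ => R) (fun _ => hR) f (inCr_of_mem_boxSet hf) ε hε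
  filter_upwards [hsub.eventually (gt_mem_nhds hδ)] with g hg
  rw [Real.dist_0_eq_abs, abs_of_nonneg (normC_nonneg _)]
  simp only [Set.domRestrict_apply, hG' g.1 (inCplus_of_mem_boxSet g.2),
    hG' f (inCplus_of_mem_boxSet hf)]
  exact hδε g.1 (inCr_of_mem_boxSet g.2) hg

/-- The operator on continuous functions induced by `G : C₊ → C₊`, and the identity where `G`
does not return a continuous function. -/
def liftOperator (G : Cfun M N → Cfun M N) (f : C(M × ℝ, Fin N → ℝ)) : C(M × ℝ, Fin N → ℝ) :=
  open Classical in if h : Continuous (G f) then ⟨G f, h⟩ else f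

lemma coe_liftOperator {G : Cfun M N → Cfun M N} (hG : mapsCplus G) (f : C(M × ℝ, Fin N → ℝ))
    (hf : inCplus (f : Cfun M N)) : (liftOperator G f : Cfun M N) = G f := by
  rw [liftOperator, dif_pos (hG f hf).1]
  rfl

lemma eNorm_sub_le_of_lipschitz {L : Cfun M N → Cfun M N} (hL : mapsCplus L) {k : ℝ}
    (hk : 0 ≤ k)
    (hLip : ∀ φ ψ, inCplus φ → inCplus ψ →
      normSup (fun p i => L φ p i - L ψ p i) ≤ k * normSup (fun p i => φ p i - ψ p i))
    {φ ψ : Cfun M N} (hφ : inCplus φ) (hψ : inCplus ψ) {c : ℝ} (hc0 : 0 ≤ c)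
    (hc : ∀ p, eNorm (fun i => φ p i - ψ p i) ≤ c) (p : M × ℝ) :
    eNorm (fun i => L φ p i - L ψ p i) ≤ k * c := by
  obtain ⟨B, hB⟩ := (hL φ hφ).2.1
  obtain ⟨B', hB'⟩ := (hL ψ hψ).2.1
  have hbd : ∀ p, eNorm (fun i => L φ p i - L ψ p i) ≤ N * (B + B') := fun p =>
    eNorm_le_of_abs_le fun i => (abs_sub _ _).trans (add_le_add (hB p i) (hB' p i))
  calc eNorm (fun i => L φ p i - L ψ p i) ≤ normSup (fun p i => L φ p i - L ψ p i) :=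
        eNorm_le_normSup (h := fun p i => L φ p i - L ψ p i) hbd p
    _ ≤ k * normSup (fun p i => φ p i - ψ p i) := hLip φ ψ hφ hψ
    _ ≤ k * c := mul_le_mul_of_nonneg_left
        (normSup_le (h := fun p i => φ p i - ψ p i) hc0 hc) hk

end Orbit

/-- Theorem A (Appendix): let `Q : (C₊,d_C) → (C₊,d_C)` be continuous with
`Q(C_{r*}) ⊆ C_{r*}` for some `r* ∈ Int(Y₊)`, and assume `Q = L + K` where
(1) `L : (C₊,‖·‖_∞) → (C₊,‖·‖_∞)` is Lipschitz with constant `k ∈ (0,1)`, and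
(2) `K : (C₊,d_C) → (C₊,d_C)` is continuous with `K(C_{r*})` precompact in
`(C,‖·‖_C)`.  Then for every `y ∈ ℝ`, the forward orbit `{(T_y∘Q)ⁿ(r*)}_{n≥1}` is
precompact in `(C,‖·‖_C)`. -/
theorem thmA {M : Type*} {N : ℕ} [MetricSpace M] [CompactSpace M]
    (Q L K : Cfun M N → Cfun M N) (rstar : M → Fin N → ℝ) (k : ℝ)
    (hrstar : inIntYplus rstar)
    (hQmaps : mapsCplus Q) (hQcont : QContinuous Q)
    (hQinv : ∀ φ, inCr rstar φ → inCr rstar (Q φ))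
    (hsplit : ∀ φ, inCplus φ → Q φ = fun p i => L φ p i + K φ p i)
    (hLmaps : mapsCplus L)
    (hk : 0 < k ∧ k < 1)
    (hLip : ∀ φ ψ, inCplus φ → inCplus ψ →
      normSup (fun p i => L φ p i - L ψ p i) ≤ k * normSup (fun p i => φ p i - ψ p i))
    (hKmaps : mapsCplus K) (hKcont : QContinuous K)
    (hKpc : seqPrecompact (K '' {φ : Cfun M N | inCr rstar φ})) :
    ∀ y : ℝ, seqPrecompact
      {ψ : Cfun M N | ∃ n : ℕ, 1 ≤ n ∧ ψ = (fun φ => Ty y (Q φ))^[n] (ofY rstar)} := by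
  intro y
  obtain ⟨B, hB, hrB⟩ : ∃ B > 0, ∀ θ i, rstar θ i ≤ B := by
    obtain ⟨b, hb⟩ := isCompact_univ.exists_bound_of_continuousOn hrstar.1.continuousOn
    refine ⟨max b 1, by positivity, fun θ i => ?_⟩
    exact (le_abs_self _).trans ((norm_le_pi_norm (rstar θ) i).trans
      ((hb θ (Set.mem_univ _)).trans (le_max_left _ _)))
  have hbox : ∀ f : C(M × ℝ, Fin N → ℝ), inCr rstar (f : Cfun M N) → f ∈ boxSet M N B :=
    fun f hf p i => ⟨hf.1.2.2 p i, (hf.2 p i).trans (hrB p.1 i)⟩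
  have horbit : ∀ n, inCr rstar ((fun φ => Ty y (Q φ))^[n] (ofY rstar)) := by
    intro n
    induction n with
    | zero =>
      obtain ⟨hc, hpos⟩ := hrstar
      refine ⟨⟨hc.comp continuous_fst, ⟨B, fun p i => ?_⟩, fun p i => (hpos p.1 i).le⟩,
        fun p i => le_rfl⟩
      exact (abs_of_pos (hpos p.1 i)).trans_le (hrB p.1 i)
    | succ n ih =>
      rw [Function.iterate_succ_apply']
      obtain ⟨⟨hc, ⟨b, hb⟩, hpos⟩, hle⟩ := hQinv _ ih
      exact ⟨⟨hc.comp (by fun_prop : Continuous fun p : M × ℝ => (p.1, p.2 - y)),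
        ⟨b, fun p i => hb _ i⟩, fun p i => hpos _ i⟩, fun p i => hle (p.1, p.2 - y) i⟩
  let u : ℕ → C(M × ℝ, Fin N → ℝ) := fun n => ⟨_, (horbit n).1.1⟩
  have hu : ∀ n, inCr rstar (u n : Cfun M N) := horbit
  have hKle : ∀ φ, inCr rstar φ → inCr rstar (K φ) := fun φ hφ =>
    ⟨hKmaps φ hφ.1, fun p i => by
      have h1 := (hQinv φ hφ).2 p i
      have h2 := (hLmaps φ hφ.1).2.2 p i
      rw [hsplit φ hφ.1] at h1
      linarith⟩
  let a : ℕ → C(M × ℝ, Fin N → ℝ) := fun n => liftOperator K (u n)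
  have ha : ∀ n, (a n : Cfun M N) = K (u n) := fun n => coe_liftOperator hKmaps (u n) (hu n).1
  have haCr : ∀ n, inCr rstar (a n : Cfun M N) := fun n => by
    rw [ha n]
    exact hKle _ (hu n)
  have hatb : TotallyBounded (Set.range a) := by
    refine totallyBounded_of_forall_tendsto_subseq fun v hv => ?_
    choose j hj using hv
    obtain ⟨g, ι, hι, hgc, hgb, hlim⟩ := hKpc (fun n => (v n : Cfun M N)) fun n =>
      ⟨u (j n), hu (j n), by rw [← hj n, ha]⟩
    refine ⟨⟨g, hgc⟩, ι, hι, tendsto_of_tendsto_normC (F := v ∘ ι) (fun n => ?_) hgb hlim⟩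
    rw [Function.comp_apply, ← hj (ι n)]
    exact (haCr _).1.2.1
  have hΛ : ∀ f : C(M × ℝ, Fin N → ℝ), inCplus (f : Cfun M N) →
      (liftOperator L f : Cfun M N) = L f := coe_liftOperator hLmaps
  have hutb : TotallyBounded (Set.range u) := by
    refine totallyBounded_range_orbit (y := y) (Λ := liftOperator L) hk.1.le hk.2 hB
      (fun n => hbox _ (hu n)) (fun n => hbox _ (haCr n)) hatb (fun n => ?_) (fun R hR => ?_)
      (fun R hR => ?_) ?_
    · ext p i
      have h1 : u (n + 1) p = Ty y (Q (u n)) p :=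
        congrFun (Function.iterate_succ_apply' (fun φ => Ty y (Q φ)) n (ofY rstar)) p
      rw [h1, hsplit _ (hu n).1, translateMap_apply, ContinuousMap.add_apply, hΛ _ (hu n).1, ha n]
      rfl
    · refine ((hQcont.continuousOn_boxSet hQmaps (coe_liftOperator hQmaps) hR).sub
        (hKcont.continuousOn_boxSet hKmaps (coe_liftOperator hKmaps) hR)).congr fun f hf => ?_
      have hf' := inCplus_of_mem_boxSet hf
      ext p i
      simp [hΛ f hf', coe_liftOperator hQmaps f hf', coe_liftOperator hKmaps f hf',
        hsplit _ hf']
    · have h0 : inCplus (0 : Cfun M N) := ⟨continuous_const, ⟨0, by simp⟩, by simp⟩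
      obtain ⟨b, hb⟩ := (hLmaps 0 h0).2.1
      refine ⟨max (b + k * (N * R)) 1, by positivity, fun f hf p i => ?_⟩
      have hf' := inCplus_of_mem_boxSet hf
      have hl := eNorm_sub_le_of_lipschitz hLmaps hk.1.le hLip hf' h0 (c := N * R)
        (by positivity) (fun p => eNorm_le_of_abs_le fun i => by
          simpa using abs_le_of_mem_boxSet hf p i) p
      rw [hΛ f hf']
      refine ⟨(hLmaps f hf').2.2 p i, le_max_of_le_left ?_⟩
      have h1 := (le_abs_self _).trans ((abs_le_eNorm _ i).trans hl)
      have h2 := (le_abs_self _).trans (hb p i)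
      linarith
    · intro R f g c hf hg hc0 hc p
      rw [hΛ f (inCplus_of_mem_boxSet hf), hΛ g (inCplus_of_mem_boxSet hg)]
      exact eNorm_sub_le_of_lipschitz hLmaps hk.1.le hLip (inCplus_of_mem_boxSet hf)
        (inCplus_of_mem_boxSet hg) hc0 hc p
  have hcpt : IsCompact (closure (Set.range u)) :=
    hutb.closure.isCompact_of_isClosed isClosed_closure
  have hcl : closure (Set.range u) ⊆ boxSet M N B :=
    closure_minimal (by rintro _ ⟨n, rfl⟩; exact hbox _ (hu n)) (isClosed_boxSet B)
  intro v hv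
  choose j _ hj using hv
  obtain ⟨g, hg, ι, hι, hlim⟩ := hcpt.isSeqCompact (x := fun n => u (j n))
    fun n => subset_closure ⟨j n, rfl⟩
  refine ⟨g, ι, hι, g.continuous, ⟨B, abs_le_of_mem_boxSet (hcl hg)⟩, ?_⟩
  simp only [hj]
  exact tendsto_normC_of_tendsto (F := fun n => u (j (ι n))) hB.le
    (fun n => abs_le_of_mem_boxSet (hbox _ (hu (j (ι n)))))
    (abs_le_of_mem_boxSet (hcl hg)) hlim
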